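/- Let α > 1, let μ, ν be probability distributions on {0,1} with ν_0, ν_1 > 0, and let P, Q be 2×2 stochastic matrices with all entries of Q strictly positive, and let f, g be the corresponding Markov path distributions on {0,1}^T. Assume μ_1/ν_1 ≤ M, P_{01}/Q_{01} ≤ M and P_{10}/Q_{10} ≤ M for some M ≥ 1, and ν_1 ≤ ρ and Q_{01} ≤ ρ for some ρ ≤ 1/2. Let Λ = P_{11}^α Q_{11}^{1−α} and assume Λ < 1, and set C = M^{2α}/(1 − Λ). Then D_α(f‖g) ≤ ((2α + 1)/(α − 1)) · C ρ T · exp(5 C ρ T). -/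

import Mathlib

open Finset

/-- Path probability of a binary Markov chain with initial distribution `μ` and transition
matrix `P`, evaluated at the path `x ∈ {0,1}^T`. -/
noncomputable def pathProb (T : ℕ) (μ : Fin 2 → ℝ) (P : Fin 2 → Fin 2 → ℝ)
    (x : Fin T → Fin 2) : ℝ :=
  (if h : 0 < T then μ (x ⟨0, h⟩) else 1) *
    ∏ t : Fin (T - 1),
      P (x ⟨t.1, lt_of_lt_of_le t.2 (Nat.sub_le T 1)⟩)
        (x ⟨t.1 + 1, Nat.add_lt_of_lt_sub t.2⟩)

/-- Rényi divergence of order `α` between the path distributions of two binary Markov chains. -/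
noncomputable def renyiPath (T : ℕ) (α : ℝ) (μ ν : Fin 2 → ℝ)
    (P Q : Fin 2 → Fin 2 → ℝ) : ℝ :=
  (α - 1)⁻¹ * Real.log (∑ x : Fin T → Fin 2, pathProb T μ P x ^ α * pathProb T ν Q x ^ (1 - α))

/-- Summing out the first vertex of a path moves the initial weight `φ` one step forward. -/
theorem sum_path_succ (n : ℕ) (φ : Fin 2 → ℝ) (A : Fin 2 → Fin 2 → ℝ) :
    ∑ x : Fin (n + 2) → Fin 2, φ (x 0) * ∏ t : Fin (n + 1), A (x t.castSucc) (x t.succ) =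
      ∑ y : Fin (n + 1) → Fin 2,
        (∑ a, φ a * A a (y 0)) * ∏ t : Fin n, A (y t.castSucc) (y t.succ) := by
  rw [← (Fin.consEquiv (fun _ : Fin (n + 2) => Fin 2)).sum_comp, Fintype.sum_prod_type,
    Finset.sum_comm]
  refine Finset.sum_congr rfl fun y _ => ?_
  rw [Finset.sum_mul]
  refine Finset.sum_congr rfl fun a _ => ?_
  rw [Fin.prod_univ_succ]
  simp [Fin.consEquiv, mul_assoc]

/-- If the weights `(1, c)` with `1 ≤ c` form a supersolution `A (1, c) ≤ r (1, c)`, then the total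
path weight grows at most like `r ^ n`. -/
theorem sum_path_le {A : Fin 2 → Fin 2 → ℝ} (hA : ∀ a b, 0 ≤ A a b) {c r : ℝ} (hc : 1 ≤ c)
    (hr : 0 ≤ r) (h0 : A 0 0 + c * A 0 1 ≤ r) (h1 : A 1 0 + c * A 1 1 ≤ r * c) (n : ℕ)
    (φ : Fin 2 → ℝ) (hφ : ∀ a, 0 ≤ φ a) :
    ∑ x : Fin (n + 1) → Fin 2, φ (x 0) * ∏ t : Fin n, A (x t.castSucc) (x t.succ) ≤
      r ^ n * (φ 0 + c * φ 1) := by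
  induction n generalizing φ with
  | zero =>
    rw [← (Equiv.funUnique (Fin 1) (Fin 2)).symm.sum_comp]
    simp only [Finset.univ_eq_empty, Finset.prod_empty, mul_one, Fin.sum_univ_two, pow_zero,
      one_mul]
    simpa using le_mul_of_one_le_left (hφ 1) hc
  | succ n ih =>
    rw [sum_path_succ]
    refine (ih (fun b => ∑ a, φ a * A a b)
      fun b => Finset.sum_nonneg fun a _ => mul_nonneg (hφ a) (hA a b)).trans ?_
    rw [pow_succ, mul_assoc]
    refine mul_le_mul_of_nonneg_left ?_ (pow_nonneg hr n)
    simp only [Fin.sum_univ_two]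
    linarith [mul_le_mul_of_nonneg_left h0 (hφ 0), mul_le_mul_of_nonneg_left h1 (hφ 1)]

theorem pathProb_rpow_mul_rpow (n : ℕ) (α : ℝ) {μ ν : Fin 2 → ℝ} {P Q : Fin 2 → Fin 2 → ℝ}
    (hμ : ∀ a, 0 ≤ μ a) (hν : ∀ a, 0 ≤ ν a) (hP : ∀ a b, 0 ≤ P a b) (hQ : ∀ a b, 0 ≤ Q a b)
    (x : Fin (n + 1) → Fin 2) :
    pathProb (n + 1) μ P x ^ α * pathProb (n + 1) ν Q x ^ (1 - α) =
      (μ (x 0) ^ α * ν (x 0) ^ (1 - α)) *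
        ∏ t : Fin n, P (x t.castSucc) (x t.succ) ^ α * Q (x t.castSucc) (x t.succ) ^ (1 - α) := by
  have key (κ : Fin 2 → ℝ) (R : Fin 2 → Fin 2 → ℝ) (hκ : ∀ a, 0 ≤ κ a) (hR : ∀ a b, 0 ≤ R a b)
      (p : ℝ) : pathProb (n + 1) κ R x ^ p =
        κ (x 0) ^ p * ∏ t : Fin n, R (x t.castSucc) (x t.succ) ^ p := by
    have h : pathProb (n + 1) κ R x = κ (x 0) * ∏ t : Fin n, R (x t.castSucc) (x t.succ) := by
      unfold pathProb
      rw [dif_pos n.succ_pos]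
      rfl
    rw [h, Real.mul_rpow (hκ _) (Finset.prod_nonneg fun _ _ => hR _ _),
      Real.finsetProd_rpow _ _ fun _ _ => hR _ _]
  rw [key μ P hμ hP, key ν Q hν hQ, Finset.prod_mul_distrib, mul_mul_mul_comm]

theorem rpow_mul_rpow_one_sub_le {p q M α : ℝ} (hα : 0 ≤ α) (hp : 0 ≤ p) (hq : 0 < q)
    (h : p / q ≤ M) : p ^ α * q ^ (1 - α) ≤ M ^ α * q := by
  rw [Real.rpow_sub hq, Real.rpow_one, mul_div_assoc', mul_div_right_comm,
    ← Real.div_rpow hp hq.le]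
  gcongr

theorem rpow_mul_rpow_one_sub_le_exp {p q ρ α : ℝ} (hα : 1 ≤ α) (hp0 : 0 ≤ p) (hp1 : p ≤ 1)
    (hρ0 : 0 ≤ ρ) (hρ : ρ ≤ 1 / 2) (hq : 1 - ρ ≤ q) :
    p ^ α * q ^ (1 - α) ≤ Real.exp (2 * (α - 1) * ρ) := by
  have hq0 : 0 < q := by linarith
  have hinv : q⁻¹ ≤ Real.exp (2 * ρ) := by
    rw [inv_le_iff_one_le_mul₀ hq0]
    calc 1 ≤ (2 * ρ + 1) * (1 - ρ) := by nlinarith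
      _ ≤ Real.exp (2 * ρ) * q := by
        gcongr
        · linarith
        · exact Real.add_one_le_exp _
  calc p ^ α * q ^ (1 - α) ≤ 1 * q ^ (1 - α) := by
        gcongr
        exact Real.rpow_le_one hp0 hp1 (by linarith)
    _ = q⁻¹ ^ (α - 1) := by rw [one_mul, Real.inv_rpow hq0.le, ← Real.rpow_neg hq0.le, neg_sub]
    _ ≤ Real.exp (2 * ρ) ^ (α - 1) := by gcongr
    _ = Real.exp (2 * (α - 1) * ρ) := by rw [← Real.exp_mul]; ring_nf

/-- Upper bound on the order-`α > 1` Rényi divergence between binary Markov chain path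
distributions: `D_α(f‖g) ≤ ((2α+1)/(α−1)) CρT exp(5CρT)`. -/
theorem renyi_divergence_bound_order_more_than_one
    (T : ℕ) (hT : 1 ≤ T) (α : ℝ) (hα : 1 < α)
    (μ ν : Fin 2 → ℝ) (hμ0 : ∀ a, 0 ≤ μ a) (hν0 : ∀ a, 0 < ν a)
    (hμ1 : ∑ a, μ a = 1) (hν1 : ∑ a, ν a = 1)
    (P Q : Fin 2 → Fin 2 → ℝ) (hP0 : ∀ a b, 0 ≤ P a b) (hQ0 : ∀ a b, 0 < Q a b)
    (hP1 : ∀ a, ∑ b, P a b = 1) (hQ1 : ∀ a, ∑ b, Q a b = 1)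
    (M : ℝ) (hM : 1 ≤ M)
    (hμM : μ 1 / ν 1 ≤ M) (hPM : P 0 1 / Q 0 1 ≤ M) (hP10M : P 1 0 / Q 1 0 ≤ M)
    (ρ : ℝ) (hρ : ρ ≤ 1 / 2) (hνρ : ν 1 ≤ ρ) (hQρ : Q 0 1 ≤ ρ)
    (Λ C : ℝ)
    (hΛ : Λ = P 1 1 ^ α * Q 1 1 ^ (1 - α)) (hΛ1 : Λ < 1)
    (hC : C = M ^ (2 * α) / (1 - Λ)) :
    renyiPath T α μ ν P Q ≤
      ((2 * α + 1) / (α - 1)) * (C * ρ * T) * Real.exp (5 * C * ρ * T) := by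
  obtain ⟨n, rfl⟩ : ∃ n, T = n + 1 := ⟨T - 1, by omega⟩
  have hρ0 : 0 < ρ := (hν0 1).trans_le hνρ
  have hα0 : 0 ≤ α := by linarith
  simp only [Fin.sum_univ_two] at hμ1 hν1 hP1 hQ1
  have hΛ0 : 0 ≤ Λ := hΛ ▸ mul_nonneg (Real.rpow_nonneg (hP0 _ _) _)
    (Real.rpow_nonneg (hQ0 _ _).le _)
  have hm : 1 ≤ M ^ α := Real.one_le_rpow hM hα0
  set c := M ^ α / (1 - Λ) with hc_def
  have hcm : c * M ^ α = C := by
    rw [hC, hc_def, two_mul, Real.rpow_add (by linarith)]; ring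
  have hc_eq : c * (1 - Λ) = M ^ α := div_mul_cancel₀ _ (by linarith)
  have hc : 1 ≤ c := by rw [hc_def, one_le_div (by linarith)]; linarith
  have hC1 : 1 ≤ C := hcm ▸ one_le_mul_of_one_le_of_one_le hc hm
  have hCρ : 0 ≤ C * ρ := by positivity
  set K := Real.exp (2 * (α - 1) * ρ)
  have hK : 1 ≤ K := Real.one_le_exp (by have := sub_pos.2 hα; positivity)
  set A : Fin 2 → Fin 2 → ℝ := fun a b => P a b ^ α * Q a b ^ (1 - α)
  set φ : Fin 2 → ℝ := fun a => μ a ^ α * ν a ^ (1 - α)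
  have hA : ∀ a b, 0 ≤ A a b := fun a b =>
    mul_nonneg (Real.rpow_nonneg (hP0 _ _) _) (Real.rpow_nonneg (hQ0 _ _).le _)
  have hφ : ∀ a, 0 ≤ φ a := fun a =>
    mul_nonneg (Real.rpow_nonneg (hμ0 _) _) (Real.rpow_nonneg (hν0 _).le _)
  have hA00 : A 0 0 ≤ K := rpow_mul_rpow_one_sub_le_exp hα.le (hP0 0 0)
    (by linarith [hP1 0, hP0 0 1]) hρ0.le hρ (by linarith [hQ1 0])
  have hA01 : A 0 1 ≤ M ^ α * ρ :=
    (rpow_mul_rpow_one_sub_le hα0 (hP0 0 1) (hQ0 0 1) hPM).trans (by gcongr)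
  have hA10 : A 1 0 ≤ M ^ α :=
    (rpow_mul_rpow_one_sub_le hα0 (hP0 1 0) (hQ0 1 0) hP10M).trans
      (mul_le_of_le_one_right (by linarith) (by linarith [hQ1 1, hQ0 1 1]))
  have hφ0 : φ 0 ≤ K := rpow_mul_rpow_one_sub_le_exp hα.le (hμ0 0)
    (by linarith [hμ0 1]) hρ0.le hρ (by linarith)
  have hφ1 : φ 1 ≤ M ^ α * ρ :=
    (rpow_mul_rpow_one_sub_le hα0 (hμ0 1) (hν0 1) hμM).trans (by gcongr)
  have hr : 1 ≤ K + C * ρ := by linarith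
  have step {u w : ℝ} (hu : u ≤ K) (hw : w ≤ M ^ α * ρ) : u + c * w ≤ K + C * ρ := by
    rw [← hcm, mul_assoc]
    gcongr
  have hA1 : A 1 0 + c * A 1 1 ≤ (K + C * ρ) * c := by
    have h11 : A 1 1 = Λ := hΛ.symm
    rw [h11]
    linarith [le_mul_of_one_le_left (zero_le_one.trans hc) hr]
  have hsum : ∑ x : Fin (n + 1) → Fin 2,
      pathProb (n + 1) μ P x ^ α * pathProb (n + 1) ν Q x ^ (1 - α) ≤ (K + C * ρ) ^ (n + 1) := by
    rw [Finset.sum_congr rfl fun x _ => pathProb_rpow_mul_rpow n α hμ0 (fun a => (hν0 a).le) hP0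
      (fun a b => (hQ0 a b).le) x, pow_succ]
    refine (sum_path_le hA hc (by linarith) (step hA00 hA01) hA1 n φ hφ).trans ?_
    exact mul_le_mul_of_nonneg_left (step hφ0 hφ1) (by positivity)
  have hKexp : K + C * ρ ≤ Real.exp ((2 * α - 1) * (C * ρ)) := by
    calc K + C * ρ ≤ K * (C * ρ + 1) := by nlinarith
      _ ≤ K * Real.exp (C * ρ) := by gcongr; exact Real.add_one_le_exp _
      _ = Real.exp (2 * (α - 1) * ρ + C * ρ) := (Real.exp_add _ _).symm
      _ ≤ Real.exp ((2 * α - 1) * (C * ρ)) := by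
        gcongr
        nlinarith [mul_nonneg (mul_nonneg (sub_nonneg.2 hα.le) hρ0.le) (sub_nonneg.2 hC1)]
  have hlog : Real.log (∑ x : Fin (n + 1) → Fin 2,
      pathProb (n + 1) μ P x ^ α * pathProb (n + 1) ν Q x ^ (1 - α)) ≤
        (2 * α + 1) * (C * ρ * (n + 1 : ℕ)) := by
    have hexp : (K + C * ρ) ^ (n + 1) ≤ Real.exp ((2 * α + 1) * (C * ρ * (n + 1 : ℕ))) := by
      calc (K + C * ρ) ^ (n + 1) ≤ Real.exp ((2 * α - 1) * (C * ρ)) ^ (n + 1) := by gcongr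
        _ = Real.exp ((n + 1 : ℕ) * ((2 * α - 1) * (C * ρ))) := (Real.exp_nat_mul _ _).symm
        _ ≤ Real.exp ((2 * α + 1) * (C * ρ * (n + 1 : ℕ))) := by
          rw [Real.exp_le_exp]
          have : 0 ≤ C * ρ * (n + 1 : ℕ) := by positivity
          linarith
    have hnonneg : 0 ≤ ∑ x : Fin (n + 1) → Fin 2,
        pathProb (n + 1) μ P x ^ α * pathProb (n + 1) ν Q x ^ (1 - α) := by
      refine Finset.sum_nonneg fun x _ => ?_
      rw [pathProb_rpow_mul_rpow n α hμ0 (fun a => (hν0 a).le) hP0 fun a b => (hQ0 a b).le]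
      exact mul_nonneg (hφ _) (Finset.prod_nonneg fun _ _ => hA _ _)
    rcases hnonneg.eq_or_lt with h | h
    · rw [← h, Real.log_zero]
      positivity
    · exact (Real.log_le_iff_le_exp h).2 (hsum.trans hexp)
  calc renyiPath (n + 1) α μ ν P Q
      ≤ (α - 1)⁻¹ * ((2 * α + 1) * (C * ρ * (n + 1 : ℕ))) :=
        mul_le_mul_of_nonneg_left hlog (inv_nonneg.2 (by linarith))
    _ = (2 * α + 1) / (α - 1) * (C * ρ * (n + 1 : ℕ)) := by ring
    _ ≤ _ := le_mul_of_one_le_right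
        (mul_nonneg (div_nonneg (by linarith) (by linarith)) (by positivity))
        (Real.one_le_exp (by positivity))
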